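/- arXiv:2301.09755 — 2 statements merged into one kernel-verified Lean document; each statement's English description precedes it below -/
import Mathlib

section
/- Let M, J, and R be fixed positive integers with R ≤ J and J ≥ 2. Suppose p¹, p² ∈ [0,1]^J and θ¹, θ² > 0 are such that the BTL-Binomial(p¹,θ¹) and BTL-Binomial(p²,θ²) distributions assign the same probability to every pair (π, x), where π ranges over ordered lists of R distinct objects from {1,…,J} and x ranges over {0,…,M}^J. Then p¹ = p². If, in addition, p¹ is not a constant vector (there exist i, j with p¹_i ≠ p¹_j), then also θ¹ = θ², i.e., the BTL-Binomial(p,θ) model is identifiable. -/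
/-- The Plackett–Luce probability of the ordered list `π = (π 0, …, π (R-1))` of objects
(drawn without replacement from `{1,…,J}`) under worths `ω`:
`∏_{r=1}^R ω_{π(r)} / (∑_{j∈S} ω_j − ∑_{s=1}^{r−1} ω_{π(s)})`. -/
noncomputable def PLprob {J R : ℕ} (ω : Fin J → ℝ) (π : Fin R → Fin J) : ℝ :=
  ∏ r : Fin R, ω (π r) / ((∑ j : Fin J, ω j) - ∑ s ∈ Finset.Iio r, ω (π s))

/-- The BTL-Binomial(p,θ) joint probability of a ranking `π` (an ordered list of `R`
distinct objects) and ratings `x : Fin J → ℕ` (each in `{0,…,M}`): the Plackett–Luce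
probability with worths `ω_j = exp(−θ p_j)` times `∏_j binom(M,x_j) p_j^{x_j} (1−p_j)^{M−x_j}`. -/
noncomputable def BTLBinomial {J R : ℕ} (M : ℕ) (p : Fin J → ℝ) (θ : ℝ)
    (π : Fin R → Fin J) (x : Fin J → ℕ) : ℝ :=
  PLprob (fun j => Real.exp (-θ * p j)) π *
    ∏ j : Fin J, (M.choose (x j) : ℝ) * p j ^ (x j) * (1 - p j) ^ (M - x j)

open Finset in
/-- For a list of distinct objects, the Plackett–Luce denominators are the total worths of the
objects not yet drawn. -/
theorem PLprob_eq_prod_div_sum_compl {J R : ℕ} (ω : Fin J → ℝ) {π : Fin R → Fin J}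
    (hπ : Function.Injective π) :
    PLprob ω π = ∏ r : Fin R, ω (π r) / ∑ j ∈ ((Iio r).image π)ᶜ, ω j := by
  refine prod_congr rfl fun r _ => ?_
  rw [← sum_compl_add_sum ((Iio r).image π) ω, sum_image hπ.injOn, add_sub_cancel_right]

theorem mem_compl_image_Iio {J R : ℕ} {π : Fin R → Fin J} (hπ : Function.Injective π)
    (r : Fin R) : π r ∈ ((Finset.Iio r).image π)ᶜ := by
  simp [hπ.eq_iff]

theorem PLprob_pos {J R : ℕ} {ω : Fin J → ℝ} (hω : ∀ j, 0 < ω j) {π : Fin R → Fin J}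
    (hπ : Function.Injective π) : 0 < PLprob ω π := by
  rw [PLprob_eq_prod_div_sum_compl ω hπ]
  exact Finset.prod_pos fun r _ => div_pos (hω _)
    (Finset.sum_pos (fun j _ => hω j) ⟨_, mem_compl_image_Iio hπ r⟩)

theorem sum_binomial_weights (M : ℕ) (q : ℝ) :
    ∑ k ∈ Finset.range (M + 1), (M.choose k : ℝ) * q ^ k * (1 - q) ^ (M - k) = 1 := by
  have h := add_pow q (1 - q) M
  rw [add_sub_cancel, one_pow] at h
  exact (Finset.sum_congr rfl fun k _ => by ring).trans h.symm

theorem sum_piFinset_BTLBinomial {J R : ℕ} (M : ℕ) (p : Fin J → ℝ) (θ : ℝ)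
    (π : Fin R → Fin J) (t : Fin J → Finset ℕ) :
    ∑ x ∈ Fintype.piFinset t, BTLBinomial M p θ π x =
      PLprob (fun j => Real.exp (-θ * p j)) π *
        ∏ j, ∑ k ∈ t j, (M.choose k : ℝ) * p j ^ k * (1 - p j) ^ (M - k) := by
  rw [Finset.prod_univ_sum, Finset.mul_sum]
  rfl

/-- Summing out all ratings recovers the Plackett–Luce probability of the ranking. -/
theorem sum_BTLBinomial {J R : ℕ} (M : ℕ) (p : Fin J → ℝ) (θ : ℝ) (π : Fin R → Fin J) :
    ∑ x ∈ Fintype.piFinset fun _ => Finset.range (M + 1), BTLBinomial M p θ π x =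
      PLprob (fun j => Real.exp (-θ * p j)) π := by
  simp [sum_piFinset_BTLBinomial, sum_binomial_weights]

/-- Summing out all ratings except that of object `i`, which is fixed to be zero. -/
theorem sum_BTLBinomial_rating_zero {J R : ℕ} (M : ℕ) (p : Fin J → ℝ) (θ : ℝ)
    (π : Fin R → Fin J) (i : Fin J) :
    ∑ x ∈ Fintype.piFinset (Function.update (fun _ => Finset.range (M + 1)) i {0}),
      BTLBinomial M p θ π x = PLprob (fun j => Real.exp (-θ * p j)) π * (1 - p i) ^ M := by
  rw [sum_piFinset_BTLBinomial, Finset.prod_eq_single i]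
  · simp
  · intro j _ hj
    rw [Function.update_of_ne hj, sum_binomial_weights]
  · simp

/-- Some ordered list draws, at each step, an object minimizing `p` among those remaining. -/
theorem exists_greedy_list {J R : ℕ} (hRJ : R ≤ J) (p : Fin J → ℝ) :
    ∃ π : Fin R → Fin J, Function.Injective π ∧
      ∀ r, ∀ j ∈ ((Finset.Iio r).image π)ᶜ, p (π r) ≤ p j := by
  refine ⟨fun r => Tuple.sort p (Fin.castLE hRJ r),
    (Tuple.sort p).injective.comp (Fin.castLE_injective hRJ), fun r j hj => ?_⟩
  obtain ⟨k, rfl⟩ := (Tuple.sort p).surjective j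
  refine Tuple.monotone_sort p (not_lt.mp fun hk => ?_)
  rw [Finset.mem_compl] at hj
  have hkr : k.val < r.val := hk
  exact hj (Finset.mem_image.mpr ⟨⟨k, hkr.trans r.isLt⟩, Finset.mem_Iio.mpr hkr, rfl⟩)

theorem exp_mul_exp_le {θ₁ θ₂ a b : ℝ} (hθ : θ₁ < θ₂) (hab : a ≤ b) :
    Real.exp (-θ₁ * a) * Real.exp (-θ₂ * b) ≤ Real.exp (-θ₂ * a) * Real.exp (-θ₁ * b) := by
  rw [← Real.exp_add, ← Real.exp_add, Real.exp_le_exp]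
  nlinarith

theorem exp_mul_exp_lt {θ₁ θ₂ a b : ℝ} (hθ : θ₁ < θ₂) (hab : a < b) :
    Real.exp (-θ₁ * a) * Real.exp (-θ₂ * b) < Real.exp (-θ₂ * a) * Real.exp (-θ₁ * b) := by
  rw [← Real.exp_add, ← Real.exp_add, Real.exp_lt_exp]
  nlinarith

/-- The probability of a greedy list is strictly increasing in `θ` when `p` is not constant. -/
theorem PLprob_exp_strictMono {J R : ℕ} (hR : 1 ≤ R) {p : Fin J → ℝ}
    (hp : ∃ i j, p i ≠ p j) {π : Fin R → Fin J} (hπ : Function.Injective π)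
    (hmin : ∀ r, ∀ j ∈ ((Finset.Iio r).image π)ᶜ, p (π r) ≤ p j) :
    StrictMono fun θ : ℝ => PLprob (fun j => Real.exp (-θ * p j)) π := by
  intro θ₁ θ₂ hθ
  have hpos : ∀ (θ : ℝ) (r : Fin R),
      0 < ∑ j ∈ ((Finset.Iio r).image π)ᶜ, Real.exp (-θ * p j) := fun θ r =>
    Finset.sum_pos (fun j _ => Real.exp_pos _) ⟨_, mem_compl_image_Iio hπ r⟩
  simp only [PLprob_eq_prod_div_sum_compl _ hπ]
  refine Finset.prod_lt_prod (fun r _ => div_pos (Real.exp_pos _) (hpos θ₁ r))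
    (fun r _ => ?_) ⟨⟨0, hR⟩, Finset.mem_univ _, ?_⟩
  · rw [div_le_div_iff₀ (hpos θ₁ r) (hpos θ₂ r), Finset.mul_sum, Finset.mul_sum]
    exact Finset.sum_le_sum fun j hj => exp_mul_exp_le hθ (hmin r j hj)
  · have hmem : ∀ j, j ∈ ((Finset.Iio (⟨0, hR⟩ : Fin R)).image π)ᶜ := by
      simp [Fin.lt_def]
    obtain ⟨j, hj⟩ : ∃ j, p (π ⟨0, hR⟩) < p j := by
      by_contra! hle
      obtain ⟨i, j, hij⟩ := hp
      have heq : ∀ k, p k = p (π ⟨0, hR⟩) := fun k =>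
        le_antisymm (hle k) (hmin _ k (hmem k))
      exact hij ((heq i).trans (heq j).symm)
    rw [div_lt_div_iff₀ (hpos θ₁ _) (hpos θ₂ _), Finset.mul_sum, Finset.mul_sum]
    exact Finset.sum_lt_sum (fun j hj => exp_mul_exp_le hθ (hmin _ j hj))
      ⟨j, hmem j, exp_mul_exp_lt hθ hj⟩

/-- Identifiability of the BTL-Binomial model: if the BTL-Binomial(p¹,θ¹) and
BTL-Binomial(p²,θ²) distributions agree on every pair (π, x), then `p¹ = p²`, and if
moreover `p¹` is not constant, then also `θ¹ = θ²`. -/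
theorem btlBinomial_identifiable (M J R : ℕ) (hM : 0 < M) (hR : 1 ≤ R) (hRJ : R ≤ J)
    (hJ : 2 ≤ J) (p₁ p₂ : Fin J → ℝ)
    (hp₁ : ∀ j, p₁ j ∈ Set.Icc (0 : ℝ) 1) (hp₂ : ∀ j, p₂ j ∈ Set.Icc (0 : ℝ) 1)
    (θ₁ θ₂ : ℝ) (hθ₁ : 0 < θ₁) (hθ₂ : 0 < θ₂)
    (h : ∀ π : Fin R → Fin J, Function.Injective π →
      ∀ x : Fin J → ℕ, (∀ j, x j ≤ M) →
        BTLBinomial M p₁ θ₁ π x = BTLBinomial M p₂ θ₂ π x) :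
    p₁ = p₂ ∧ ((∃ i j, p₁ i ≠ p₁ j) → θ₁ = θ₂) := by
  have hPL : ∀ π : Fin R → Fin J, Function.Injective π →
      PLprob (fun j => Real.exp (-θ₁ * p₁ j)) π = PLprob (fun j => Real.exp (-θ₂ * p₂ j)) π := by
    intro π hπ
    rw [← sum_BTLBinomial M, ← sum_BTLBinomial M]
    refine Finset.sum_congr rfl fun x hx => h π hπ x fun j => ?_
    exact Nat.lt_succ_iff.mp (Finset.mem_range.mp (Fintype.mem_piFinset.mp hx j))
  have hp : p₁ = p₂ := by
    funext i
    have hπ := Fin.castLE_injective hRJ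
    have hsum : PLprob (fun j => Real.exp (-θ₁ * p₁ j)) (Fin.castLE hRJ) * (1 - p₁ i) ^ M =
        PLprob (fun j => Real.exp (-θ₂ * p₂ j)) (Fin.castLE hRJ) * (1 - p₂ i) ^ M := by
      rw [← sum_BTLBinomial_rating_zero, ← sum_BTLBinomial_rating_zero]
      refine Finset.sum_congr rfl fun x hx => h _ hπ x fun j => ?_
      have hxj := Fintype.mem_piFinset.mp hx j
      rcases eq_or_ne j i with rfl | hji
      · simp_all
      · rw [Function.update_of_ne hji, Finset.mem_range] at hxj
        exact Nat.lt_succ_iff.mp hxj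
    rw [hPL _ hπ] at hsum
    have hpow := mul_left_cancel₀ (PLprob_pos (fun j => Real.exp_pos (-θ₂ * p₂ j)) hπ).ne' hsum
    have := (pow_left_inj₀ (sub_nonneg.mpr (hp₁ i).2) (sub_nonneg.mpr (hp₂ i).2) hM.ne').mp hpow
    linarith
  refine ⟨hp, fun hne => ?_⟩
  subst hp
  obtain ⟨π, hπ, hmin⟩ := exists_greedy_list hRJ p₁
  exact (PLprob_exp_strictMono hR hne hπ hmin).injective (hPL π hπ)
end

section
/- Let J ≥ 2, 1 ≤ R ≤ J, p ∈ [0,1]^J with p_i ≠ p_j for some i ≠ j, and θ¹, θ² > 0. If for every ordered list π of R distinct elements of {1,…,J} the Plackett–Luce probability of π computed with worths ω_j = exp(−θ¹ p_j) equals the Plackett–Luce probability of π computed with worths ω_j = exp(−θ² p_j), then θ¹ = θ². -/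
/-- The Plackett–Luce probability of the first `R` entries of a permutation `σ`, written with the
total worth of the objects still available at each stage. -/
theorem PLprob_perm_castLE {J R : ℕ} (hRJ : R ≤ J) (ω : Fin J → ℝ) (σ : Equiv.Perm (Fin J)) :
    PLprob ω (fun r => σ (Fin.castLE hRJ r)) =
      ∏ r : Fin R, ω (σ (Fin.castLE hRJ r)) / ∑ k ∈ Finset.Ici (Fin.castLE hRJ r), ω (σ k) := by
  unfold PLprob
  refine Finset.prod_congr rfl fun r _ => ?_
  congr 1
  have himage : (Finset.Iio r).map (Fin.castLEEmb hRJ) = Finset.Iio (Fin.castLE hRJ r) := by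
    ext k
    simp only [Finset.mem_map, Finset.mem_Iio, Fin.castLEEmb_apply]
    constructor
    · rintro ⟨s, hs, rfl⟩
      exact hs
    · intro hk
      exact ⟨⟨k, lt_trans hk r.2⟩, hk, rfl⟩
  have hprefix : ∑ s ∈ Finset.Iio r, ω (σ (Fin.castLE hRJ s)) =
      ∑ k ∈ Finset.Iio (Fin.castLE hRJ r), ω (σ k) := by
    rw [← himage, Finset.sum_map]
    rfl
  have hcompl : (Finset.Iio (Fin.castLE hRJ r))ᶜ = Finset.Ici (Fin.castLE hRJ r) := by
    ext k
    simp
  rw [hprefix, ← Equiv.sum_comp σ ω, sub_eq_iff_eq_add, ← hcompl, Finset.sum_compl_add_sum]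

theorem exp_div_sum_exp {ι : Type*} (s : Finset ι) (q : ι → ℝ) (i : ι) (θ : ℝ) :
    Real.exp (-θ * q i) / ∑ k ∈ s, Real.exp (-θ * q k) =
      (∑ k ∈ s, Real.exp (-θ * (q k - q i)))⁻¹ := by
  have hfactor : ∑ k ∈ s, Real.exp (-θ * q k) =
      Real.exp (-θ * q i) * ∑ k ∈ s, Real.exp (-θ * (q k - q i)) := by
    rw [Finset.mul_sum]
    refine Finset.sum_congr rfl fun k _ => ?_
    rw [← Real.exp_add]
    ring_nf
  rw [hfactor, div_mul_cancel_left₀ (Real.exp_ne_zero _)]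

/-- The probability of listing the objects by increasing `p` is strictly increasing in `θ`. -/
theorem strictMono_PLprob_sort {J R : ℕ} (hR : 1 ≤ R) (hRJ : R ≤ J) (p : Fin J → ℝ)
    (hp : ∃ i j, i ≠ j ∧ p i ≠ p j) :
    StrictMono fun θ : ℝ => PLprob (fun j => Real.exp (-θ * p j))
      (fun r : Fin R => Tuple.sort p (Fin.castLE hRJ r)) := by
  intro θ₁ θ₂ hθ
  have hmono : Monotone fun k => p (Tuple.sort p k) := Tuple.monotone_sort p
  simp only [PLprob_perm_castLE]
  simp only [exp_div_sum_exp _ (fun k => p (Tuple.sort p k))]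
  have hpos (θ : ℝ) (r : Fin R) : 0 < ∑ k ∈ Finset.Ici (Fin.castLE hRJ r),
      Real.exp (-θ * (p (Tuple.sort p k) - p (Tuple.sort p (Fin.castLE hRJ r)))) :=
    Finset.sum_pos (fun _ _ => Real.exp_pos _) ⟨_, Finset.mem_Ici.2 le_rfl⟩
  have hterm (r k : Fin J) (hk : k ∈ Finset.Ici r) :
      Real.exp (-θ₂ * (p (Tuple.sort p k) - p (Tuple.sort p r))) ≤
        Real.exp (-θ₁ * (p (Tuple.sort p k) - p (Tuple.sort p r))) := by
    have hle : p (Tuple.sort p r) ≤ p (Tuple.sort p k) := hmono (Finset.mem_Ici.1 hk)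
    exact Real.exp_le_exp.2 (by nlinarith)
  refine Finset.prod_lt_prod (fun r _ => inv_pos.2 (hpos θ₁ r))
    (fun r _ => inv_anti₀ (hpos θ₂ r) (Finset.sum_le_sum (hterm _))) ⟨⟨0, hR⟩, Finset.mem_univ _, ?_⟩
  refine inv_strictAnti₀ (hpos θ₂ _) (Finset.sum_lt_sum (hterm _) ?_)
  set z : Fin J := Fin.castLE hRJ ⟨0, hR⟩
  have hz (k : Fin J) : z ≤ k := Nat.zero_le k
  obtain ⟨k, hk⟩ : ∃ k, p (Tuple.sort p z) < p (Tuple.sort p k) := by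
    by_contra! hconst
    obtain ⟨i, j, -, hij⟩ := hp
    have heq (i : Fin J) : p i = p (Tuple.sort p z) := by
      have hle := hconst ((Tuple.sort p).symm i)
      have hge : p (Tuple.sort p z) ≤ p (Tuple.sort p ((Tuple.sort p).symm i)) := hmono (hz _)
      rw [Equiv.apply_symm_apply] at hle hge
      exact le_antisymm hle hge
    exact hij ((heq i).trans (heq j).symm)
  exact ⟨k, Finset.mem_Ici.2 (hz k), Real.exp_lt_exp.2 (by nlinarith)⟩

/-- If `p` is not constant and the Plackett–Luce distributions with worths
`exp(−θ¹ p_j)` and `exp(−θ² p_j)` agree on every ordered list of `R` distinct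
elements of `{1,…,J}`, then `θ¹ = θ²`. -/
theorem plackettLuce_theta_identifiable (J R : ℕ) (hJ : 2 ≤ J) (hR : 1 ≤ R) (hRJ : R ≤ J)
    (p : Fin J → ℝ) (hp : ∀ j, p j ∈ Set.Icc (0 : ℝ) 1)
    (hpnc : ∃ i j, i ≠ j ∧ p i ≠ p j)
    (θ₁ θ₂ : ℝ) (hθ₁ : 0 < θ₁) (hθ₂ : 0 < θ₂)
    (h : ∀ π : Fin R → Fin J, Function.Injective π →
      PLprob (fun j => Real.exp (-θ₁ * p j)) π =
        PLprob (fun j => Real.exp (-θ₂ * p j)) π) :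
    θ₁ = θ₂ := by
  exact (strictMono_PLprob_sort hR hRJ p hpnc).injective
    (h _ ((Tuple.sort p).injective.comp (Fin.castLE_injective hRJ)))
end
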